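/- Let f : {−1,1}^n → {−1,1}, let ε > 0, and let T' ⊆ T ⊆ [n] satisfy Σ_{S⊆T'} f̂(S)² ≥ Σ_{S⊆T} f̂(S)² − ε²/4. Then | E_{x uniform}[|f_{avg,T}(x)|] − E_{x uniform}[|f_{avg,T'}(x)|] | ≤ ε; equivalently, the maximal correlations of f with juntas on T and with juntas on T' differ by at most ε. -/

import Mathlib

open Finset

noncomputable section

/-- The real sign of a Boolean bit: `true ↦ 1`, `false ↦ -1`. -/
def sgnB (b : Bool) : ℝ := if b then 1 else -1

/-- The character `χ_S(x) = ∏_{i ∈ S} x_i` on the cube `{±1}^n`. -/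
def chi {n : ℕ} (S : Finset (Fin n)) (x : Fin n → Bool) : ℝ := ∏ i ∈ S, sgnB (x i)

/-- The Fourier coefficient `f̂(S) = 2^{-n} ∑_x f(x) χ_S(x)`. -/
def fhat {n : ℕ} (f : (Fin n → Bool) → ℝ) (S : Finset (Fin n)) : ℝ :=
  (∑ x : Fin n → Bool, f x * chi S x) / 2 ^ n

/-- Expectation over a uniformly random point of the cube. -/
def expect {n : ℕ} (f : (Fin n → Bool) → ℝ) : ℝ := (∑ x : Fin n → Bool, f x) / 2 ^ n

/-- `f_{avg,T}(x) = ∑_{S ⊆ T} f̂(S) χ_S(x)`, the conditional expectation of `f` given `x_T`. -/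
def favg {n : ℕ} (f : (Fin n → Bool) → ℝ) (T : Finset (Fin n)) (x : Fin n → Bool) : ℝ :=
  ∑ S ∈ T.powerset, fhat f S * chi S x

/-- `g` is a junta on `T` if it depends only on the coordinates in `T`. -/
def IsJuntaOn {n : ℕ} (g : (Fin n → Bool) → ℝ) (T : Finset (Fin n)) : Prop :=
  ∀ x y : Fin n → Bool, (∀ i ∈ T, x i = y i) → g x = g y

/-- The restriction `f_{B→z}`, viewed as a function on the whole cube that
ignores the coordinates in `B` (they are fixed to `z`). -/
def restrictF {n : ℕ} (f : (Fin n → Bool) → ℝ) (B : Finset (Fin n)) (z : Fin n → Bool) :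
    (Fin n → Bool) → ℝ :=
  fun x => f (fun i => if i ∈ B then z i else x i)

/-- Expectation over a `δ`-random restriction `(J, z) ∼ R_δ`: `J` contains each
coordinate independently with probability `δ`, and `z` is uniform (only its values
outside `J` matter for the functionals we apply this to). -/
def Erestrict {n : ℕ} (δ : ℝ) (F : Finset (Fin n) → (Fin n → Bool) → ℝ) : ℝ :=
  ∑ J : Finset (Fin n), δ ^ J.card * (1 - δ) ^ (n - J.card) *
    ((∑ z : Fin n → Bool, F J z) / 2 ^ n)

/-- `dist(f,g) = Pr_x[f(x) ≠ g(x)]`. -/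
def distF {n : ℕ} (f g : (Fin n → Bool) → ℝ) : ℝ :=
  expect (fun x => if f x = g x then 0 else 1)
/-- Orthogonality of the characters on the cube. -/
theorem sum_chi_mul_chi {n : ℕ} (S U : Finset (Fin n)) :
    ∑ x : Fin n → Bool, chi S x * chi U x = if S = U then 2 ^ n else 0 := by
  have h : ∀ x : Fin n → Bool, chi S x * chi U x =
      ∏ i, ((if i ∈ S then sgnB (x i) else 1) * (if i ∈ U then sgnB (x i) else 1)) := by
    intro x
    rw [Finset.prod_mul_distrib]
    simp only [chi, Finset.prod_ite_mem, Finset.univ_inter]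
  simp_rw [h]
  rw [← Fintype.prod_sum fun (i : Fin n) (b : Bool) =>
    (if i ∈ S then sgnB b else 1) * (if i ∈ U then sgnB b else 1)]
  split_ifs with hSU
  · subst hSU
    rw [Finset.prod_congr rfl (g := fun _ => (2 : ℝ))]
    · simp
    · intro i _
      by_cases hi : i ∈ S <;> simp [hi, sgnB] <;> norm_num
  · obtain ⟨i, hi⟩ : ∃ i, ¬(i ∈ S ↔ i ∈ U) := by
      by_contra! hc
      exact hSU (Finset.ext hc)
    apply Finset.prod_eq_zero (Finset.mem_univ i)
    by_cases h1 : i ∈ S <;> by_cases h2 : i ∈ U <;> simp_all [sgnB]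

/-- Parseval's identity for a combination of characters. -/
theorem expect_sum_chi_sq {n : ℕ} (A : Finset (Finset (Fin n))) (c : Finset (Fin n) → ℝ) :
    expect (fun x => (∑ S ∈ A, c S * chi S x) ^ 2) = ∑ S ∈ A, c S ^ 2 := by
  have h : ∑ x : Fin n → Bool, (∑ S ∈ A, c S * chi S x) ^ 2 = (∑ S ∈ A, c S ^ 2) * 2 ^ n := by
    calc ∑ x : Fin n → Bool, (∑ S ∈ A, c S * chi S x) ^ 2
        = ∑ x : Fin n → Bool, ∑ S ∈ A, ∑ U ∈ A, c S * c U * (chi S x * chi U x) := by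
          refine Finset.sum_congr rfl fun x _ => ?_
          rw [sq, Finset.sum_mul_sum]
          exact Finset.sum_congr rfl fun S _ => Finset.sum_congr rfl fun U _ => by ring
      _ = ∑ S ∈ A, ∑ U ∈ A, c S * c U * ∑ x : Fin n → Bool, chi S x * chi U x := by
          rw [Finset.sum_comm]
          refine Finset.sum_congr rfl fun S _ => ?_
          rw [Finset.sum_comm]
          exact Finset.sum_congr rfl fun U _ => (Finset.mul_sum _ _ _).symm
      _ = (∑ S ∈ A, c S ^ 2) * 2 ^ n := by
          rw [Finset.sum_mul]
          refine Finset.sum_congr rfl fun S hS => ?_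
          simp [sum_chi_mul_chi, hS, sq]
  rw [_root_.expect, h, mul_div_cancel_right₀ _ (by positivity)]

/-- The Cauchy–Schwarz bound for the difference of first absolute moments. -/
theorem sq_expect_abs_sub_expect_abs_le {n : ℕ} (g h : (Fin n → Bool) → ℝ) :
    (expect (fun x => |g x|) - expect (fun x => |h x|)) ^ 2 ≤ expect (fun x => (g x - h x) ^ 2) := by
  have hcs := sq_sum_le_card_mul_sum_sq (s := (Finset.univ : Finset (Fin n → Bool)))
    (f := fun x => |g x| - |h x|)
  have hle : ∑ x : Fin n → Bool, (|g x| - |h x|) ^ 2 ≤ ∑ x : Fin n → Bool, (g x - h x) ^ 2 :=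
    Finset.sum_le_sum fun x _ => sq_le_sq.mpr (abs_abs_sub_abs_le_abs_sub _ _)
  have hcard : ((Finset.univ : Finset (Fin n → Bool)).card : ℝ) = 2 ^ n := by simp
  rw [hcard] at hcs
  have hpos : (0 : ℝ) < 2 ^ n := by positivity
  rw [_root_.expect, _root_.expect, _root_.expect, ← sub_div, ← Finset.sum_sub_distrib, div_pow,
    div_le_div_iff₀ (by positivity) hpos]
  nlinarith [mul_le_mul_of_nonneg_left hle hpos.le]

/-- The squared distance between two nested averages is the Fourier mass lost. -/
theorem expect_favg_sub_favg_sq {n : ℕ} (f : (Fin n → Bool) → ℝ) {T' T : Finset (Fin n)}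
    (hsub : T' ⊆ T) :
    expect (fun x => (favg f T x - favg f T' x) ^ 2) =
      ∑ S ∈ T.powerset, fhat f S ^ 2 - ∑ S ∈ T'.powerset, fhat f S ^ 2 := by
  have hP := Finset.powerset_mono.mpr hsub
  rw [← Finset.sum_sdiff_eq_sub hP, ← expect_sum_chi_sq]
  simp_rw [favg, ← Finset.sum_sdiff_eq_sub hP]

/-- small loss of Fourier mass means small loss in best junta
correlation. -/
theorem small_mass_loss_okay (n : ℕ) (f : (Fin n → Bool) → ℝ)
    (hf : ∀ x, f x = 1 ∨ f x = -1) (ε : ℝ) (hε : 0 < ε)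
    (T' T : Finset (Fin n)) (hsub : T' ⊆ T)
    (hmass : ∑ S ∈ T.powerset, fhat f S ^ 2 - ε ^ 2 / 4
        ≤ ∑ S ∈ T'.powerset, fhat f S ^ 2) :
    |expect (fun x => |favg f T x|) - expect (fun x => |favg f T' x|)| ≤ ε := by
  have h := (sq_expect_abs_sub_expect_abs_le (favg f T) (favg f T')).trans_eq
    (expect_favg_sub_favg_sq f hsub)
  exact abs_le_of_sq_le_sq (by nlinarith [sq_nonneg ε]) hε.le
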